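/- arXiv:1609.02826 — 3 statements merged into one kernel-verified Lean document; each statement's English description precedes it below -/
import Mathlib

section
/- Let a, b, c, d, e, f, g, h be real numbers and let W₁ be the 7×7 real symmetric matrix whose only nonzero entries are (W₁)₁₂ = (W₁)₂₁ = a, (W₁)₁₃ = (W₁)₃₁ = b, (W₁)₂₃ = (W₁)₃₂ = c, (W₁)₂₄ = (W₁)₄₂ = d, (W₁)₃₅ = (W₁)₅₃ = e, (W₁)₄₅ = (W₁)₅₄ = f, (W₁)₄₆ = (W₁)₆₄ = g, (W₁)₅₇ = (W₁)₇₅ = h. Suppose a·b·c·g·h ≠ 0. Then: if a·b·c > 0, W₁ has exactly 3 positive eigenvalues and exactly 4 negative eigenvalues; and if a·b·c < 0, W₁ has exactly 4 positive eigenvalues and exactly 3 negative eigenvalues (eigenvalues counted with multiplicity). -/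
open Matrix

/-- Number of positive eigenvalues (with multiplicity) of a real symmetric matrix. -/
noncomputable def nPos {n : Type*} [Fintype n] [DecidableEq n] (A : Matrix n n ℝ) : ℕ :=
  if hA : A.IsHermitian then Fintype.card {i // 0 < hA.eigenvalues i} else 0

/-- Number of negative eigenvalues (with multiplicity) of a real symmetric matrix. -/
noncomputable def nNeg {n : Type*} [Fintype n] [DecidableEq n] (A : Matrix n n ℝ) : ℕ :=
  if hA : A.IsHermitian then Fintype.card {i // hA.eigenvalues i < 0} else 0

/-- The independence number of a graph. -/
noncomputable def indepNum {V : Type*} [Fintype V] (G : SimpleGraph V) : ℕ :=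
  sSup {k | ∃ s : Finset V, s.card = k ∧ ∀ i ∈ s, ∀ j ∈ s, i ≠ j → ¬ G.Adj i j}

/-- A weight matrix of a graph: real symmetric, zero on non-adjacent pairs. -/
def IsWeightMatrix {V : Type*} (G : SimpleGraph V) (W : Matrix V V ℝ) : Prop :=
  W.IsHermitian ∧ ∀ i j, ¬ G.Adj i j → W i j = 0

/-- An optimal weight matrix: the inertia bound is attained. -/
noncomputable def IsOptimalWeightMatrix {V : Type*} [Fintype V] [DecidableEq V]
    (G : SimpleGraph V) (W : Matrix V V ℝ) : Prop :=
  IsWeightMatrix G W ∧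
    indepNum G = min (Fintype.card V - nPos W) (Fintype.card V - nNeg W)

/-- If a real symmetric matrix vanishes on `S × S`, then at most `|Sᶜ|` of its eigenvalues have
the sign of a given `ε`. -/
theorem Matrix.IsHermitian.card_eigenvalues_sign_le {n : Type*} [Fintype n] [DecidableEq n]
    {A : Matrix n n ℝ} (hA : A.IsHermitian) (ε : ℝ) (S : Finset n)
    (hS : ∀ i ∈ S, ∀ j ∈ S, A i j = 0) :
    Fintype.card {i // 0 < ε * hA.eigenvalues i} ≤ Sᶜ.card := by
  classical
  let U : Matrix n n ℝ := hA.eigenvectorUnitary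
  let E : ({i // 0 < ε * hA.eigenvalues i} → ℝ) →ₗ[ℝ] (n → ℝ) :=
    Function.ExtendByZero.linearMap ℝ Subtype.val
  let R : (n → ℝ) →ₗ[ℝ] ({i // i ∈ Sᶜ} → ℝ) := LinearMap.funLeft ℝ ℝ Subtype.val
  have hinj : Function.Injective (R ∘ₗ U.mulVecLin ∘ₗ E) := by
    rw [← LinearMap.ker_eq_bot, LinearMap.ker_eq_bot']
    intro y hy
    have hx : ∀ i ∉ S, (U *ᵥ E y) i = 0 := fun i hi =>
      congrFun hy ⟨i, Finset.mem_compl.2 hi⟩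
    have hzero : (U *ᵥ E y) ⬝ᵥ (A *ᵥ (U *ᵥ E y)) = 0 := by
      set x := U *ᵥ E y
      simp only [dotProduct, mulVec, Finset.mul_sum]
      refine Finset.sum_eq_zero fun i _ => Finset.sum_eq_zero fun j _ => ?_
      by_cases hi : i ∈ S
      · by_cases hj : j ∈ S
        · simp [hS i hi j hj]
        · simp [hx j hj]
      · simp [hx i hi]
    have hdiag : Uᵀ * A * U = diagonal hA.eigenvalues := by
      have := hA.conjStarAlgAut_star_eigenvectorUnitary
      rw [Unitary.conjStarAlgAut_star_apply] at this
      simpa [U, star_eq_conjTranspose, Function.comp_def] using this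
    have hform : (U *ᵥ E y) ⬝ᵥ (A *ᵥ (U *ᵥ E y)) = ∑ i, hA.eigenvalues i * (E y i) ^ 2 := by
      have : (U *ᵥ E y) ⬝ᵥ (A *ᵥ (U *ᵥ E y)) = E y ⬝ᵥ ((Uᵀ * A * U) *ᵥ E y) := by
        rw [← mulVec_mulVec, ← mulVec_mulVec, dotProduct_mulVec (E y), vecMul_transpose]
      rw [this, hdiag]
      simp only [dotProduct, mulVec_diagonal]
      exact Finset.sum_congr rfl fun i _ => by ring
    have hval : ∀ i, E y i.1 = y i := fun i =>
      Subtype.val_injective.extend_apply y 0 i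
    have hnonneg : ∀ i ∈ Finset.univ, 0 ≤ ε * (hA.eigenvalues i * (E y i) ^ 2) := by
      intro i _
      by_cases hi : 0 < ε * hA.eigenvalues i
      · rw [← mul_assoc]
        positivity
      · have : E y i = 0 := Function.extend_apply' _ _ _ (by rintro ⟨j, rfl⟩; exact hi j.2)
        simp [this]
    have hsum : ∑ i, ε * (hA.eigenvalues i * (E y i) ^ 2) = 0 := by
      rw [← Finset.mul_sum, ← hform, hzero, mul_zero]
    ext i
    have := (Finset.sum_eq_zero_iff_of_nonneg hnonneg).1 hsum i.1 (Finset.mem_univ _)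
    rw [← mul_assoc, hval] at this
    simpa [i.2.ne'] using this
  simpa [Finset.card_compl] using LinearMap.finrank_le_finrank_of_injective hinj

/-- The sign of a nonzero determinant is the parity of the number of negative eigenvalues. -/
theorem Matrix.IsHermitian.neg_one_pow_card_mul_det_pos {n : Type*} [Fintype n] [DecidableEq n]
    {A : Matrix n n ℝ} (hA : A.IsHermitian) (hdet : A.det ≠ 0) :
    0 < (-1) ^ Fintype.card {i // hA.eigenvalues i < 0} * A.det := by
  have hprod : A.det = ∏ i, hA.eigenvalues i := by simpa using hA.det_eq_prod_eigenvalues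
  have hne : ∀ i, hA.eigenvalues i ≠ 0 := fun i =>
    Finset.prod_ne_zero_iff.1 (hprod ▸ hdet) i (Finset.mem_univ i)
  have hpow : (-1 : ℝ) ^ Fintype.card {i // hA.eigenvalues i < 0} =
      ∏ i, if hA.eigenvalues i < 0 then (-1) else 1 := by
    rw [Fintype.card_subtype, Finset.prod_ite]
    simp
  rw [hpow, hprod, ← Finset.prod_mul_distrib]
  refine Finset.prod_pos fun i _ => ?_
  split_ifs with hi
  · linarith
  · linarith [lt_of_le_of_ne (not_lt.1 hi) (hne i).symm]

/-- A nonsingular real symmetric matrix has only positive and negative eigenvalues. -/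
theorem Matrix.IsHermitian.card_pos_add_card_neg {n : Type*} [Fintype n] [DecidableEq n]
    {A : Matrix n n ℝ} (hA : A.IsHermitian) (hdet : A.det ≠ 0) :
    Fintype.card {i // 0 < hA.eigenvalues i} + Fintype.card {i // hA.eigenvalues i < 0} =
      Fintype.card n := by
  have hprod : A.det = ∏ i, hA.eigenvalues i := by simpa using hA.det_eq_prod_eigenvalues
  have hne : ∀ i, hA.eigenvalues i ≠ 0 := fun i =>
    Finset.prod_ne_zero_iff.1 (hprod ▸ hdet) i (Finset.mem_univ i)
  have hiff : ∀ i, hA.eigenvalues i < 0 ↔ ¬ 0 < hA.eigenvalues i := fun i =>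
    ⟨fun hi => hi.not_gt, fun hi => lt_of_le_of_ne (not_lt.1 hi) (hne i)⟩
  rw [Fintype.card_congr (Equiv.subtypeEquivRight hiff), Fintype.card_subtype_compl]
  have := Fintype.card_subtype_le fun i => 0 < hA.eigenvalues i
  omega

/-- For the weight matrix `W₁` of the graph `G₁` (with edge weights
`a, …, h` as displayed), if `a·b·c·g·h ≠ 0` then: `a·b·c > 0` gives inertia `(3, 4)` and
`a·b·c < 0` gives inertia `(4, 3)`. -/
theorem stmt8 (a b c d e f g h : ℝ) (W₁ : Matrix (Fin 7) (Fin 7) ℝ)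
    (hW₁ : W₁ = !![0, a, b, 0, 0, 0, 0;
                   a, 0, c, d, 0, 0, 0;
                   b, c, 0, 0, e, 0, 0;
                   0, d, 0, 0, f, g, 0;
                   0, 0, e, f, 0, 0, h;
                   0, 0, 0, g, 0, 0, 0;
                   0, 0, 0, 0, h, 0, 0])
    (hne : a * b * c * g * h ≠ 0) :
    (0 < a * b * c → nPos W₁ = 3 ∧ nNeg W₁ = 4) ∧
    (a * b * c < 0 → nPos W₁ = 4 ∧ nNeg W₁ = 3) := by
  have hA : W₁.IsHermitian := by
    subst hW₁
    ext i j
    fin_cases i <;> fin_cases j <;> simp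
  have hdet : W₁.det = 2 * (a * b * c) * (g * h) ^ 2 := by
    subst hW₁
    rw [det_succ_row _ 6, Finset.sum_eq_single 4 (by intro j; fin_cases j <;> simp) (by simp),
      det_succ_column _ 5, Finset.sum_eq_single 4
        (by intro j; fin_cases j <;> simp [Fin.succAbove]) (by simp),
      det_succ_row _ 4, Finset.sum_eq_single 3
        (by intro j; fin_cases j <;> simp [Fin.succAbove]) (by simp),
      det_succ_column _ 3, Finset.sum_eq_single 3
        (by intro j; fin_cases j <;> simp [Fin.succAbove]) (by simp),
      det_fin_three]
    simp [Fin.succAbove]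
    ring
  have hgh : 0 < (g * h) ^ 2 := by
    have : g * h ≠ 0 := fun h0 => hne (by rw [mul_assoc, h0, mul_zero])
    positivity
  have habc : a * b * c ≠ 0 := fun h0 => hne (by rw [h0]; ring)
  have hdet0 : W₁.det ≠ 0 := by
    rw [hdet]
    exact mul_ne_zero (mul_ne_zero two_ne_zero habc) hgh.ne'
  have hS : ∀ i ∈ ({0, 5, 6} : Finset (Fin 7)), ∀ j ∈ ({0, 5, 6} : Finset (Fin 7)),
      W₁ i j = 0 := by
    subst hW₁
    simp
  have hcard : ({0, 5, 6} : Finset (Fin 7))ᶜ.card = 4 := by decide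
  have hpos := hA.card_eigenvalues_sign_le 1 _ hS
  have hneg := hA.card_eigenvalues_sign_le (-1) _ hS
  simp only [one_mul, neg_mul, Left.neg_pos_iff, hcard] at hpos hneg
  have hsum := hA.card_pos_add_card_neg hdet0
  have hsign := hA.neg_one_pow_card_mul_det_pos hdet0
  rw [Fintype.card_fin] at hsum
  simp only [nPos, nNeg, dif_pos hA]
  generalize Fintype.card {i // 0 < hA.eigenvalues i} = p at *
  generalize Fintype.card {i // hA.eigenvalues i < 0} = q at *
  rw [hdet] at hsign
  have hq : (p = 3 ∧ q = 4) ∨ (p = 4 ∧ q = 3) := by omega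
  rcases hq with ⟨rfl, rfl⟩ | ⟨rfl, rfl⟩
  · refine ⟨fun _ => ⟨rfl, rfl⟩, fun hlt => ?_⟩
    nlinarith [mul_pos (neg_pos.2 hlt) hgh]
  · refine ⟨fun hlt => ?_, fun _ => ⟨rfl, rfl⟩⟩
    nlinarith [mul_pos hlt hgh]
end

section
/- Let a, b, c, d, e, f, g, h, i be real numbers and let W₂ be the 7×7 real symmetric matrix whose only nonzero entries are (W₂)₁₂ = (W₂)₂₁ = a, (W₂)₂₃ = (W₂)₃₂ = b, (W₂)₂₄ = (W₂)₄₂ = c, (W₂)₂₅ = (W₂)₅₂ = d, (W₂)₃₄ = (W₂)₄₃ = e, (W₂)₃₆ = (W₂)₆₃ = f, (W₂)₄₅ = (W₂)₅₄ = g, (W₂)₅₇ = (W₂)₇₅ = h, (W₂)₆₇ = (W₂)₇₆ = i. Suppose a·e·f·g·h·i ≠ 0. Then: if e·f·g·h·i < 0, W₂ has exactly 3 positive eigenvalues and exactly 4 negative eigenvalues; and if e·f·g·h·i > 0, W₂ has exactly 4 positive eigenvalues and exactly 3 negative eigenvalues (eigenvalues counted with multiplicity). -/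
open Matrix

/-- The quadratic form of a real symmetric matrix in an orthonormal eigenbasis. -/
theorem Matrix.IsHermitian.dotProduct_mulVec_eq_sum {n : Type*} [Fintype n] [DecidableEq n]
    {A : Matrix n n ℝ} (hA : A.IsHermitian) (x : n → ℝ) :
    x ⬝ᵥ A *ᵥ x =
      ∑ i, hA.eigenvalues i * ((star (hA.eigenvectorUnitary : Matrix n n ℝ)) *ᵥ x) i ^ 2 := by
  have hstar : star (hA.eigenvectorUnitary : Matrix n n ℝ) =
      (hA.eigenvectorUnitary : Matrix n n ℝ)ᵀ := by
    rw [star_eq_conjTranspose, conjTranspose_eq_transpose_of_trivial]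
  conv_lhs => rw [hA.spectral_theorem, Unitary.conjStarAlgAut_apply]
  rw [← mulVec_mulVec, ← mulVec_mulVec, dotProduct_mulVec, ← mulVec_transpose, ← hstar]
  simp only [dotProduct, mulVec_diagonal, Function.comp_apply, RCLike.ofReal_real_eq_id, id_eq]
  exact Finset.sum_congr rfl fun i _ => by ring

/-- If a principal submatrix vanishes, its size is at most the number of eigenvalues `μ` with
`0 ≤ σ * μ`, for either sign of `σ`. -/
theorem Matrix.IsHermitian.card_le_card_eigenvalues {n : Type*} [Fintype n] [DecidableEq n]
    {A : Matrix n n ℝ} (hA : A.IsHermitian) (S : Finset n)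
    (hS : ∀ i ∈ S, ∀ j ∈ S, A i j = 0) (σ : ℝ) :
    S.card ≤ Fintype.card {i // 0 ≤ σ * hA.eigenvalues i} := by
  set U : Matrix n n ℝ := (hA.eigenvectorUnitary : Matrix n n ℝ) with hU
  let ext : (S → ℝ) →ₗ[ℝ] (n → ℝ) := Function.ExtendByZero.linearMap ℝ (Subtype.val : S → n)
  have ext_mem (x : S → ℝ) (i : S) : ext x i = x i :=
    Subtype.val_injective.extend_apply _ _ _
  have ext_notMem (x : S → ℝ) (i : n) (hi : i ∉ S) : ext x i = 0 :=
    Function.extend_apply' _ _ _ (by rintro ⟨j, rfl⟩; exact hi j.2)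
  let coord : (S → ℝ) →ₗ[ℝ] ({i // 0 ≤ σ * hA.eigenvalues i} → ℝ) :=
    LinearMap.funLeft ℝ ℝ Subtype.val ∘ₗ (star U).mulVecLin ∘ₗ ext
  have hinj : Function.Injective coord := by
    refine (injective_iff_map_eq_zero coord).2 fun x hx => ?_
    have hcoord (i : n) (hi : 0 ≤ σ * hA.eigenvalues i) : (star U *ᵥ ext x) i = 0 :=
      congrFun hx ⟨i, hi⟩
    have hform : ext x ⬝ᵥ A *ᵥ ext x = 0 := by
      simp only [dotProduct, mulVec, Finset.mul_sum]
      refine Finset.sum_eq_zero fun i _ => Finset.sum_eq_zero fun j _ => ?_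
      by_cases hi : i ∈ S
      · by_cases hj : j ∈ S
        · simp [hS i hi j hj]
        · simp [ext_notMem x j hj]
      · simp [ext_notMem x i hi]
    have hsum : ∑ i, -(σ * hA.eigenvalues i) * (star U *ᵥ ext x) i ^ 2 = 0 := by
      rw [hA.dotProduct_mulVec_eq_sum] at hform
      simp only [neg_mul, mul_assoc, Finset.sum_neg_distrib, ← Finset.mul_sum, hU, hform,
        mul_zero, neg_zero]
    have hnonneg (i : n) : 0 ≤ -(σ * hA.eigenvalues i) * (star U *ᵥ ext x) i ^ 2 := by
      rcases le_or_gt 0 (σ * hA.eigenvalues i) with hi | hi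
      · simp [hcoord i hi]
      · have := neg_pos.2 hi
        positivity
    have hzero : star U *ᵥ ext x = 0 := by
      funext i
      rcases le_or_gt 0 (σ * hA.eigenvalues i) with hi | hi
      · exact hcoord i hi
      · have := (Finset.sum_eq_zero_iff_of_nonneg fun i _ => hnonneg i).1 hsum i
          (Finset.mem_univ i)
        simpa [(neg_pos.2 hi).ne', hi.ne, left_ne_zero_of_mul hi.ne,
          right_ne_zero_of_mul hi.ne] using this
    have hext : ext x = 0 := by
      have h : U *ᵥ (star U *ᵥ ext x) = ext x := by
        rw [mulVec_mulVec, hU, Unitary.mul_star_self_of_mem hA.eigenvectorUnitary.2, one_mulVec]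
      rw [← h, hzero, mulVec_zero]
    funext i
    rw [← ext_mem x i, hext]
    rfl
  simpa using LinearMap.finrank_le_finrank_of_injective hinj

theorem nPos_add_nNeg {n : Type*} [Fintype n] [DecidableEq n] {A : Matrix n n ℝ}
    (hA : A.IsHermitian) (hdet : A.det ≠ 0) : nPos A + nNeg A = Fintype.card n := by
  rw [hA.det_eq_prod_eigenvalues] at hdet
  have hne (i : n) : hA.eigenvalues i ≠ 0 := by
    simpa using Finset.prod_ne_zero_iff.1 hdet i (Finset.mem_univ i)
  rw [nPos, nNeg, dif_pos hA, dif_pos hA, add_comm,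
    ← Fintype.card_congr (Equiv.sumCompl fun i => hA.eigenvalues i < 0), Fintype.card_sum]
  congr 1
  exact Fintype.card_congr (Equiv.subtypeEquivRight fun i => by
    rw [not_lt, (hne i).symm.le_iff_lt])

theorem neg_one_pow_nNeg_mul_det_pos {n : Type*} [Fintype n] [DecidableEq n] {A : Matrix n n ℝ}
    (hA : A.IsHermitian) (hdet : A.det ≠ 0) : 0 < (-1) ^ nNeg A * A.det := by
  have hpow : (-1 : ℝ) ^ nNeg A = ∏ i, if hA.eigenvalues i < 0 then -1 else 1 := by
    rw [nNeg, dif_pos hA, Finset.prod_ite, Finset.prod_const, Finset.prod_const_one, mul_one,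
      Fintype.card_subtype]
  rw [hA.det_eq_prod_eigenvalues] at hdet ⊢
  rw [hpow, ← Finset.prod_mul_distrib]
  refine Finset.prod_pos fun i hi => ?_
  have hne : hA.eigenvalues i ≠ 0 := by simpa using Finset.prod_ne_zero_iff.1 hdet i hi
  rcases hne.lt_or_gt with h | h
  · simp [h]
  · simp [h, h.not_gt]

/-- A vanishing principal submatrix of a nonsingular symmetric matrix bounds both `nPos` and
`nNeg` from below by its size. -/
theorem card_le_nPos_and_card_le_nNeg {n : Type*} [Fintype n] [DecidableEq n]
    {A : Matrix n n ℝ} (hA : A.IsHermitian) (hdet : A.det ≠ 0) (S : Finset n)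
    (hS : ∀ i ∈ S, ∀ j ∈ S, A i j = 0) : S.card ≤ nPos A ∧ S.card ≤ nNeg A := by
  rw [nPos, nNeg, dif_pos hA, dif_pos hA]
  rw [hA.det_eq_prod_eigenvalues] at hdet
  have hne (i : n) : hA.eigenvalues i ≠ 0 := by
    simpa using Finset.prod_ne_zero_iff.1 hdet i (Finset.mem_univ i)
  constructor
  · refine (hA.card_le_card_eigenvalues S hS 1).trans_eq ?_
    exact Fintype.card_congr (Equiv.subtypeEquivRight fun i => by
      rw [one_mul, (hne i).symm.le_iff_lt])
  · refine (hA.card_le_card_eigenvalues S hS (-1)).trans_eq ?_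
    exact Fintype.card_congr (Equiv.subtypeEquivRight fun i => by
      rw [neg_one_mul, neg_nonneg, (hne i).le_iff_lt])

/-- For the weight matrix `W₂` of the graph `G₂` (with edge weights
`a, …, i` as displayed), if `a·e·f·g·h·i ≠ 0` then: `e·f·g·h·i < 0` gives inertia `(3, 4)`
and `e·f·g·h·i > 0` gives inertia `(4, 3)`. -/
theorem stmt10 (a b c d e f g h i : ℝ) (W₂ : Matrix (Fin 7) (Fin 7) ℝ)
    (hW₂ : W₂ = !![0, a, 0, 0, 0, 0, 0;
                   a, 0, b, c, d, 0, 0;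
                   0, b, 0, e, 0, f, 0;
                   0, c, e, 0, g, 0, 0;
                   0, d, 0, g, 0, 0, h;
                   0, 0, f, 0, 0, 0, i;
                   0, 0, 0, 0, h, i, 0])
    (hne : a * e * f * g * h * i ≠ 0) :
    (e * f * g * h * i < 0 → nPos W₂ = 3 ∧ nNeg W₂ = 4) ∧
    (0 < e * f * g * h * i → nPos W₂ = 4 ∧ nNeg W₂ = 3) := by
  have hdet : W₂.det = -2 * a ^ 2 * (e * f * g * h * i) := by
    rw [hW₂]
    simp [det_succ_row_zero, Fin.sum_univ_succ, Fin.succAbove]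
    ring
  have ha : 0 < a ^ 2 := by
    have : a ≠ 0 := by rintro rfl; simp at hne
    positivity
  have hprod : e * f * g * h * i ≠ 0 := fun h0 => hne <| by linear_combination a * h0
  have hdet_ne : W₂.det ≠ 0 := by
    rw [hdet]
    exact mul_ne_zero (mul_ne_zero (by norm_num) ha.ne') hprod
  have hA : W₂.IsHermitian := by
    rw [hW₂]
    ext j k
    fin_cases j <;> fin_cases k <;> rfl
  have hsum := nPos_add_nNeg hA hdet_ne
  have hsign := neg_one_pow_nNeg_mul_det_pos hA hdet_ne
  have hindep : ∀ j ∈ ({0, 3, 5} : Finset (Fin 7)), ∀ k ∈ ({0, 3, 5} : Finset (Fin 7)),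
      W₂ j k = 0 := by
    simp [hW₂]
  obtain ⟨hpos, hneg⟩ := card_le_nPos_and_card_le_nNeg hA hdet_ne {0, 3, 5} hindep
  have hcard : ({0, 3, 5} : Finset (Fin 7)).card = 3 := rfl
  rw [hcard] at hpos hneg
  rw [Fintype.card_fin] at hsum
  have hcases : nNeg W₂ = 3 ∨ nNeg W₂ = 4 := by omega
  constructor <;> intro hp <;> rcases hcases with hk | hk <;> rw [hk, hdet] at hsign
  · nlinarith
  · omega
  · omega
  · nlinarith
end

section
/- Let G be an α-critical simple graph and let W be an optimal weight matrix of G. Then W i j ≠ 0 for every edge {i, j} of G. -/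
open Matrix

/-- **Inertia bound.** If the principal submatrix on `S` of a real symmetric matrix vanishes,
then the number of eigenvalues of a given strict sign is at most the size of the complement
of `S`. The sign is selected by the scalar `c`. -/
theorem card_eigenvalues_add_card_le {V : Type*} [Fintype V] [DecidableEq V]
    {W : Matrix V V ℝ} (hW : W.IsHermitian) (S : Finset V)
    (hS : ∀ i ∈ S, ∀ j ∈ S, W i j = 0) (c : ℝ) (p : V → Prop) [DecidablePred p]
    (hp : ∀ i, p i → 0 < c * hW.eigenvalues i) :
    Fintype.card {i // p i} + S.card ≤ Fintype.card V := by
  set U : Matrix V V ℝ := hW.eigenvectorUnitary.val with hU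
  have hdiag : Uᵀ * W * U = diagonal hW.eigenvalues := by
    have h := hW.conjStarAlgAut_star_eigenvectorUnitary
    rw [Unitary.conjStarAlgAut_star_apply] at h
    simpa [hU, star_eq_conjTranspose, Function.comp_def] using h
  let L : ({i // p i} → ℝ) →ₗ[ℝ] ({i // i ∉ S} → ℝ) :=
    LinearMap.funLeft ℝ ℝ Subtype.val ∘ₗ U.mulVecLin ∘ₗ
      Function.ExtendByZero.linearMap ℝ Subtype.val
  have hL : Function.Injective L := by
    rw [injective_iff_map_eq_zero]
    intro a ha
    let b : V → ℝ := Function.extend Subtype.val a 0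
    have hx : ∀ i, i ∉ S → (U *ᵥ b) i = 0 := fun i hi => congrFun ha ⟨i, hi⟩
    have hquad : (U *ᵥ b) ⬝ᵥ (W *ᵥ (U *ᵥ b)) = 0 := by
      refine Finset.sum_eq_zero fun i _ => ?_
      by_cases hi : i ∈ S
      · refine mul_eq_zero_of_right _ (Finset.sum_eq_zero fun j _ => ?_)
        by_cases hj : j ∈ S
        · exact mul_eq_zero_of_left (hS i hi j hj) _
        · exact mul_eq_zero_of_right _ (hx j hj)
      · rw [hx i hi, zero_mul]
    have hsum : ∑ i, c * hW.eigenvalues i * b i ^ 2 = 0 := by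
      have h : (U *ᵥ b) ⬝ᵥ (W *ᵥ (U *ᵥ b)) = b ⬝ᵥ (diagonal hW.eigenvalues *ᵥ b) := by
        rw [← hdiag, ← mulVec_mulVec, ← mulVec_mulVec, dotProduct_mulVec b, vecMul_transpose]
      rw [hquad] at h
      calc ∑ i, c * hW.eigenvalues i * b i ^ 2
          = c * (b ⬝ᵥ (diagonal hW.eigenvalues *ᵥ b)) := by
            simp only [dotProduct, mulVec_diagonal, Finset.mul_sum]
            exact Finset.sum_congr rfl fun i _ => by ring
        _ = 0 := by rw [← h, mul_zero]
    have hbp : ∀ k : {i // p i}, b k = a k := fun k =>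
      Subtype.val_injective.extend_apply a (0 : V → ℝ) k
    have hbn : ∀ i, ¬ p i → b i = 0 := fun i hi =>
      Function.extend_apply' a (0 : V → ℝ) i fun ⟨k, hk⟩ => hi (hk ▸ k.2)
    have hnonneg : ∀ i ∈ Finset.univ, 0 ≤ c * hW.eigenvalues i * b i ^ 2 := by
      intro i _
      by_cases hi : p i
      · exact mul_nonneg (hp i hi).le (sq_nonneg _)
      · simp [hbn i hi]
    ext k
    have h := (Finset.sum_eq_zero_iff_of_nonneg hnonneg).1 hsum k (Finset.mem_univ _)
    rw [hbp] at h
    simpa using (mul_eq_zero.1 h).resolve_left (hp k k.2).ne'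
  have hcard := LinearMap.finrank_le_finrank_of_injective hL
  rw [Module.finrank_fintype_fun_eq_card, Module.finrank_fintype_fun_eq_card,
    Fintype.card_subtype_compl, Fintype.card_coe] at hcard
  have := S.card_le_univ
  omega

/-- The independence number is bounded by the inertia of any weight matrix. -/
theorem indepNum_le_min_inertia {V : Type*} [Fintype V] [DecidableEq V] {G : SimpleGraph V}
    {W : Matrix V V ℝ} (hW : IsWeightMatrix G W) :
    indepNum G ≤ min (Fintype.card V - nPos W) (Fintype.card V - nNeg W) := by
  refine csSup_le ⟨0, ∅, by simp⟩ ?_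
  rintro _ ⟨S, rfl, hS⟩
  have hzero : ∀ i ∈ S, ∀ j ∈ S, W i j = 0 := by
    intro i hi j hj
    refine hW.2 i j fun hij => ?_
    exact hS i hi j hj hij.ne hij
  have hpos := card_eigenvalues_add_card_le hW.1 S hzero 1 (fun i => 0 < hW.1.eigenvalues i)
    fun i hi => by linarith
  have hneg := card_eigenvalues_add_card_le hW.1 S hzero (-1) (fun i => hW.1.eigenvalues i < 0)
    fun i hi => by linarith
  rw [nPos, nNeg, dif_pos hW.1, dif_pos hW.1]
  refine le_min ?_ ?_ <;> omega

/-- If `G` is `α`-critical and `W` is an optimal weight matrix of `G`,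
then the entries of `W` corresponding to edges are all nonzero. -/
theorem stmt11 {V : Type*} [Fintype V] [DecidableEq V] (G : SimpleGraph V)
    (hcrit : ∀ e ∈ G.edgeSet, indepNum G < indepNum (G.deleteEdges {e}))
    (W : Matrix V V ℝ) (hW : IsOptimalWeightMatrix G W) :
    ∀ i j, G.Adj i j → W i j ≠ 0 := by
  intro i j hij h0
  have hW' : IsWeightMatrix (G.deleteEdges {s(i, j)}) W := by
    refine ⟨hW.1.1, fun k l hkl => ?_⟩
    by_cases hG : G.Adj k l
    · have he : s(k, l) = s(i, j) := by
        by_contra hne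
        exact hkl (SimpleGraph.deleteEdges_adj.2 ⟨hG, hne⟩)
      rcases Sym2.eq_iff.1 he with ⟨rfl, rfl⟩ | ⟨rfl, rfl⟩
      · exact h0
      · rw [← hW.1.1.apply, h0, star_zero]
    · exact hW.1.2 k l hG
  have hlt := hcrit s(i, j) hij
  rw [hW.2] at hlt
  exact (indepNum_le_min_inertia hW').not_gt hlt
end
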